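/- arXiv:math/0112148 — 2 statements merged into one kernel-verified Lean document; each statement's English description precedes it below -/
import Mathlib

section
/- Let δ, i, j be natural numbers and let f, g ∈ ℂ((z)) be formal Laurent series such that z^{i·δ}·f ∈ ℂ[[z]] and z^{j·δ}·g ∈ ℂ[[z]] (i.e. f and g have poles of order at most i·δ and j·δ respectively). Then z^{(i+j)·δ}·( j·g·f′ − i·f·g′ ) ∈ ℂ[[z]], where f′ denotes the formal derivative; the term of pole order (i+j)·δ + 1 cancels. In particular, if δ ≥ 1 then z^{(i+j+1)·δ}·( j·g·f′ − i·f·g′ ) ∈ z·ℂ[[z]], i.e. the bracket of two sections with poles bounded by the divisor vanishes at the point of the divisor. (This is the local statement that the Poisson bracket takes A_i^{(D)} ⊗ A_j^{(D)} to A_{i+j+1}^{(D)}, and vanishes on the fibers of the cone over the support of D.) -/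
open HahnSeries

/-- The variable `z` of the field `ℂ((z))` of formal Laurent series. -/
noncomputable def zLS : LaurentSeries ℂ := HahnSeries.single 1 1

/-- `f ∈ ℂ[[z]]`, i.e. the Laurent series `f` has no pole at `0`. -/
def memPS (f : LaurentSeries ℂ) : Prop := ∀ n : ℤ, n < 0 → f.coeff n = 0

/-- Multiplication by `z ^ k` shifts the coefficients by `k`. -/
theorem coeff_zLS_pow_mul (k : ℕ) (f : LaurentSeries ℂ) (n : ℤ) :
    (zLS ^ k * f).coeff n = f.coeff (n - k) := by
  have h : zLS ^ k = HahnSeries.single (k : ℤ) (1 : ℂ) := by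
    simp [zLS, HahnSeries.single_pow]
  rw [h, HahnSeries.coeff_single_mul, one_mul]

/-- Lower bounds on the order of vanishing add up under multiplication. -/
theorem coeff_mul_eq_zero_of_lt {f g : LaurentSeries ℂ} {k l : ℤ}
    (hf : ∀ n < k, f.coeff n = 0) (hg : ∀ n < l, g.coeff n = 0) :
    ∀ n < k + l, (f * g).coeff n = 0 := by
  intro n hn
  rw [HahnSeries.coeff_mul]
  refine Finset.sum_eq_zero fun x hx => ?_
  have hx' : x.1 + x.2 = n := (Finset.mem_antidiagonal.mp hx).2.2
  rcases lt_or_ge x.1 k with h | h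
  · rw [hf _ h, zero_mul]
  · rw [hg _ (by omega), mul_zero]

theorem natCast_mul_coeff_eq_zero_of_lt {f : LaurentSeries ℂ} {k : ℤ} (m : ℕ)
    (hf : ∀ n < k, f.coeff n = 0) :
    ∀ n < k, ((m : LaurentSeries ℂ) * f).coeff n = 0 := by
  intro n hn
  rw [← nsmul_eq_mul, HahnSeries.coeff_nsmul, Pi.smul_apply, hf n hn, smul_zero]

/-- If `z ^ a * f` is a power series then `z ^ a * (z * f' + a * f)` has no constant term. -/
theorem coeff_zLS_pow_mul_euler_eq_zero {f f' : LaurentSeries ℂ} {a : ℕ}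
    (hf' : ∀ n : ℤ, f'.coeff n = ((n + 1 : ℤ) : ℂ) * f.coeff (n + 1))
    (hf : memPS (zLS ^ a * f)) :
    ∀ n < (1 : ℤ), (zLS ^ a * (zLS * f' + (a : LaurentSeries ℂ) * f)).coeff n = 0 := by
  intro n hn
  have hz : (zLS * f').coeff (n - a) = f'.coeff (n - a - 1) := by
    simpa using coeff_zLS_pow_mul 1 f' (n - a)
  rw [coeff_zLS_pow_mul, HahnSeries.coeff_add, hz, hf', ← nsmul_eq_mul,
    HahnSeries.coeff_nsmul, Pi.smul_apply, nsmul_eq_mul, sub_add_cancel,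
    ← add_mul]
  rcases (Int.lt_add_one_iff.mp hn : n ≤ 0).lt_or_eq with h | rfl
  · have := hf n h
    rw [coeff_zLS_pow_mul] at this
    rw [this, mul_zero]
  · simp

/-- if `f` and `g` have poles of order at most `i·δ` and `j·δ`, then
`j·g·f′ − i·f·g′` has a pole of order at most `(i+j)·δ` (the term of pole order
`(i+j)·δ + 1` cancels); in particular for `δ ≥ 1` the bracket, which a priori has
a pole of order at most `(i+j+1)·δ`, in fact vanishes at the point of the divisor:
`z^{(i+j+1)·δ}·(j·g·f′ − i·f·g′) ∈ z·ℂ[[z]]`.  Here `D` is the formal derivative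
`d/dz`, characterized on coefficients by `(D f).coeff n = (n+1)·f.coeff (n+1)`. -/
theorem bracket_pole_order (δ i j : ℕ)
    (D : LaurentSeries ℂ → LaurentSeries ℂ)
    (hD : ∀ (f : LaurentSeries ℂ) (n : ℤ), (D f).coeff n = ((n + 1 : ℤ) : ℂ) * f.coeff (n + 1))
    (f g : LaurentSeries ℂ)
    (hf : memPS (zLS ^ (i * δ) * f)) (hg : memPS (zLS ^ (j * δ) * g)) :
    memPS (zLS ^ ((i + j) * δ) *
      ((j : LaurentSeries ℂ) * g * D f - (i : LaurentSeries ℂ) * f * D g)) ∧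
    (1 ≤ δ → ∀ n : ℤ, n < 1 →
      (zLS ^ ((i + j + 1) * δ) *
        ((j : LaurentSeries ℂ) * g * D f - (i : LaurentSeries ℂ) * f * D g)).coeff n = 0) := by
  have hbr : memPS (zLS ^ ((i + j) * δ) *
      ((j : LaurentSeries ℂ) * g * D f - (i : LaurentSeries ℂ) * f * D g)) := by
    have hF := natCast_mul_coeff_eq_zero_of_lt j
      (coeff_mul_eq_zero_of_lt hg (coeff_zLS_pow_mul_euler_eq_zero (hD f) hf))
    have hG := natCast_mul_coeff_eq_zero_of_lt i
      (coeff_mul_eq_zero_of_lt hf (coeff_zLS_pow_mul_euler_eq_zero (hD g) hg))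
    intro n hn
    have key : zLS ^ 1 * (zLS ^ ((i + j) * δ) *
        ((j : LaurentSeries ℂ) * g * D f - (i : LaurentSeries ℂ) * f * D g)) =
        (j : LaurentSeries ℂ) * (zLS ^ (j * δ) * g *
          (zLS ^ (i * δ) * (zLS * D f + ((i * δ : ℕ) : LaurentSeries ℂ) * f))) -
        (i : LaurentSeries ℂ) * (zLS ^ (i * δ) * f *
          (zLS ^ (j * δ) * (zLS * D g + ((j * δ : ℕ) : LaurentSeries ℂ) * g))) := by
      push_cast
      ring
    have hc := congrArg (fun h => h.coeff (n + 1)) key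
    simp only [coeff_zLS_pow_mul 1, HahnSeries.coeff_sub] at hc
    rw [hF _ (by omega), hG _ (by omega)] at hc
    simpa using hc
  refine ⟨hbr, fun hδ n hn => ?_⟩
  rw [add_mul (i + j) 1 δ, one_mul, add_comm, _root_.pow_add, mul_assoc, coeff_zLS_pow_mul]
  exact hbr _ (by omega)
end

section
/- Let K = ℂ((z)) be the field of formal Laurent series with the derivation ∂ = d/dz, and let ℓ ∈ ℂ. Then: (i) there is a unique element v ∈ ΨDO(K,∂)_{≤0} satisfying v = e₁ + ℓ·( e₁ * (z^{−1}·e₀) * v ); it satisfies v_0 = 0 and v_1 = 1 (v represents (D − ℓ·z^{−1})^{−1}); (ii) there is a unique ℂ-algebra automorphism T of ΨDO(K,∂)_{≤0} that is continuous for the topology defined by the filtration F^i = {a : a_n = 0 for n < i}, fixes g·e₀ for every g ∈ ℂ((z)), and sends e₁ to v. (T is the restriction to operators of degree ≤ 0 of the unique continuous automorphism of ΨDO(ℂ((z)), d/dz) taking D to D − ℓ/z and leaving z fixed, denoted A ↦ z^ℓ·A·z^{−ℓ} in the paper.) -/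
/-- The generalized binomial coefficient `−n choose m`:
`c(0,0) = 1`, `c(0,m) = 0` for `m > 0`, `c(n,m) = (−1)^m · choose (n+m−1) m` for `n ≥ 1`. -/
def pdoCoeff (n m : ℕ) : ℤ := (-1) ^ m * (Nat.choose (n + m - 1) m : ℤ)

/-- The product of `ΨDO(R,∂)_{≤0}`, modeled on sequences `a : ℕ → R`
(`a` represents `∑_{n≥0} a_n D^{−n}`):
`(a*b)_k = ∑_{n+m+l=k} c(n,m)·a_n·∂^m(b_l)`. -/
def pdoMul {R : Type*} [CommRing R] (d : R → R) (a b : ℕ → R) : ℕ → R :=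
  fun k => ∑ n ∈ Finset.range (k + 1), ∑ m ∈ Finset.range (k + 1 - n),
    pdoCoeff n m • (a n * d^[m] (b (k - n - m)))


/-- The sequence `e₀` representing `1`. -/
def pdoOne {R : Type*} [CommRing R] : ℕ → R := fun n => if n = 0 then 1 else 0

/-- The sequence `g·e₀` representing the scalar `g ∈ R`. -/
def pdoScalar {R : Type*} [CommRing R] (r : R) : ℕ → R := fun n => if n = 0 then r else 0

/-- The sequence `e₁` representing `D⁻¹`. -/
def pdoE1 {R : Type*} [CommRing R] : ℕ → R := fun n => if n = 1 then 1 else 0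

/-- Multiplication by `D⁻¹` on the right: the sequence shifted by one place. -/
def pdoShift {M : Type*} [Zero M] (a : ℕ → M) : ℕ → M
  | 0 => 0
  | k + 1 => a k

theorem existsUnique_eq_of_strictly_causal {M : Type*} [Zero M] (F : (ℕ → M) → ℕ → M)
    (hF : ∀ (k : ℕ) (a b : ℕ → M), (∀ j < k, a j = b j) → F a k = F b k) :
    ∃! v : ℕ → M, v = F v := by
  have hstab : ∀ k n, k < n → F^[n] 0 k = F^[k + 1] 0 k := by
    intro k
    induction k using Nat.strong_induction_on with
    | _ k ih =>
      intro n hn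
      obtain ⟨n, rfl⟩ : ∃ n', n = n' + 1 := ⟨n - 1, by omega⟩
      rw [Function.iterate_succ_apply', Function.iterate_succ_apply']
      refine hF _ _ _ fun j hj => ?_
      rw [ih j hj n (by omega), ih j hj k hj]
  refine ⟨fun k => F^[k + 1] 0 k, ?_, ?_⟩
  · funext k
    rw [Function.iterate_succ_apply']
    exact hF _ _ _ fun j hj => hstab j k hj
  · intro w hw
    funext k
    induction k using Nat.strong_induction_on with
    | _ k ih =>
      rw [hw, Function.iterate_succ_apply']
      refine hF _ _ _ fun j hj => ?_
      rw [ih j hj, hstab j k hj]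

theorem addMonoidHom_eq_of_eq_single {R M : Type*} [AddCommGroup R] [AddCommGroup M]
    (f g : (ℕ → R) →+ M) (j : ℕ)
    (hf : ∀ a : ℕ → R, (∀ n < j, a n = 0) → f a = 0)
    (hg : ∀ a : ℕ → R, (∀ n < j, a n = 0) → g a = 0)
    (h : ∀ n r, f (Pi.single n r) = g (Pi.single n r)) : f = g := by
  ext a
  have hs : ∀ n, n < j → (∑ i ∈ Finset.range j, Pi.single i (a i) : ℕ → R) n = a n := by
    intro n hn
    rw [Finset.sum_apply, Finset.sum_pi_single]
    simp [hn]
  have h0 : ∀ n < j, (a - ∑ i ∈ Finset.range j, Pi.single i (a i) : ℕ → R) n = 0 := by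
    intro n hn
    rw [Pi.sub_apply, hs n hn, sub_self]
  have h1 := hf _ h0
  have h2 := hg _ h0
  rw [map_sub, sub_eq_zero] at h1 h2
  rw [h1, h2, map_sum, map_sum]
  exact Finset.sum_congr rfl fun n _ => h n _

theorem pdoCoeff_zero_right (n : ℕ) : pdoCoeff n 0 = 1 := by simp [pdoCoeff]

theorem pdoCoeff_zero_succ (m : ℕ) : pdoCoeff 0 (m + 1) = 0 := by simp [pdoCoeff]

theorem pdoCoeff_pascal (n m : ℕ) :
    pdoCoeff n (m + 1) = pdoCoeff (n + 1) (m + 1) + pdoCoeff (n + 1) m := by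
  have h1 : n + 1 + (m + 1) - 1 = n + m + 1 := by omega
  have h2 : n + 1 + m - 1 = n + m := by omega
  have h3 : n + (m + 1) - 1 = n + m := by omega
  rw [pdoCoeff, pdoCoeff, pdoCoeff, h1, h2, h3, Nat.choose_succ_succ]
  push_cast
  ring

section Algebra

variable {S R E : Type*} [CommRing S] [CommRing R] [Algebra S R] [Ring E]

theorem pdoScalar_eq_single (r : R) : pdoScalar r = Pi.single 0 r := by
  funext n
  simp [pdoScalar, Pi.single_apply]

theorem pdoE1_eq_single : (pdoE1 : ℕ → R) = Pi.single 1 1 := by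
  funext n
  simp [pdoE1, Pi.single_apply]

theorem pdoShift_single (n : ℕ) (r : R) :
    pdoShift (Pi.single n r : ℕ → R) = Pi.single (n + 1) r := by
  funext k
  cases k <;> simp [pdoShift, Pi.single_apply]

theorem pdoMul_add_left (d : R → R) (a a' b : ℕ → R) :
    pdoMul d (a + a') b = pdoMul d a b + pdoMul d a' b := by
  funext k
  simp only [pdoMul, Pi.add_apply, add_mul, smul_add, Finset.sum_add_distrib]

theorem pdoMul_eq_zero_of_lt (d : R → R) (a b : ℕ → R) {k : ℕ} (h : ∀ n < k, a n = 0) :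
    ∀ n < k, pdoMul d a b n = 0 := by
  intro n hn
  refine Finset.sum_eq_zero fun i hi => Finset.sum_eq_zero fun m _ => ?_
  rw [h i (by rw [Finset.mem_range] at hi; omega), zero_mul, smul_zero]

theorem pdoMul_congr_right (d : R → R) (a : ℕ → R) (ha : a 0 = 0) (k : ℕ) (b b' : ℕ → R)
    (h : ∀ j < k, b j = b' j) : pdoMul d a b k = pdoMul d a b' k := by
  refine Finset.sum_congr rfl fun n hn => Finset.sum_congr rfl fun m _ => ?_
  rcases Nat.eq_zero_or_pos n with rfl | hn0
  · rw [ha, zero_mul, zero_mul]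
  · rw [h _ (by rw [Finset.mem_range] at hn; omega)]

theorem pdoMul_single_zero_left (d : R → R) (r : R) (b : ℕ → R) :
    pdoMul d (Pi.single 0 r) b = fun k => r * b k := by
  funext k
  rw [pdoMul, Finset.sum_eq_single 0, Finset.sum_eq_single 0]
  · simp [pdoCoeff_zero_right]
  · intro m _ hm
    obtain ⟨m, rfl⟩ := Nat.exists_eq_succ_of_ne_zero hm
    rw [Nat.succ_eq_add_one, pdoCoeff_zero_succ, zero_smul]
  · simp
  · intro n _ hn
    simp [hn]
  · simp

theorem pdoMul_shift_left (d : Derivation S R R) (a b b' : ℕ → R) (h0 : b' 0 = 0)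
    (h : ∀ k, b' (k + 1) + d (b' k) = b k) :
    pdoMul d (pdoShift a) b = pdoMul d a b' := by
  funext k
  cases k with
  | zero => simp [pdoMul, pdoShift, h0]
  | succ k =>
    rw [pdoMul, Finset.sum_range_succ', pdoMul, Finset.sum_range_succ _ (k + 1)]
    have e1 : ∑ m ∈ Finset.range (k + 1 + 1 - 0), pdoCoeff 0 m •
        (pdoShift a 0 * d^[m] (b (k + 1 - 0 - m))) = 0 := by
      refine Finset.sum_eq_zero fun m _ => ?_
      simp [pdoShift]
    have e2 : ∑ m ∈ Finset.range (k + 1 + 1 - (k + 1)), pdoCoeff (k + 1) m •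
        (a (k + 1) * d^[m] (b' (k + 1 - (k + 1) - m))) = 0 := by
      refine Finset.sum_eq_zero fun m hm => ?_
      have : m = 0 := by rw [Finset.mem_range] at hm; omega
      subst this
      simp [h0]
    rw [e1, e2]
    congr 1
    refine Finset.sum_congr rfl fun n hn => ?_
    obtain ⟨N, rfl⟩ : ∃ N, k = n + N := ⟨k - n, by rw [Finset.mem_range] at hn; omega⟩
    have i1 : n + N + 1 + 1 - (n + 1) = N + 1 := by omega
    have i2 : n + N + 1 + 1 - n = N + 1 + 1 := by omega
    rw [i1, i2]
    have hL : ∀ m ∈ Finset.range (N + 1), pdoCoeff (n + 1) m •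
        (pdoShift a (n + 1) * d^[m] (b (n + N + 1 - (n + 1) - m))) =
        pdoCoeff (n + 1) m • (a n * d^[m] (b' (N + 1 - m))) +
        pdoCoeff (n + 1) m • (a n * d^[m + 1] (b' (N - m))) := by
      intro m hm
      rw [Finset.mem_range] at hm
      have j1 : n + N + 1 - (n + 1) - m = N - m := by omega
      have j2 : N + 1 - m = N - m + 1 := by omega
      rw [j1, j2, ← h, iterate_map_add, Function.iterate_succ_apply, ← smul_add, ← mul_add]
      rfl
    have hR : ∀ m, pdoCoeff n m • (a n * d^[m] (b' (n + N + 1 - n - m))) =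
        pdoCoeff n m • (a n * d^[m] (b' (N + 1 - m))) := by
      intro m
      have j1 : n + N + 1 - n - m = N + 1 - m := by omega
      rw [j1]
    rw [Finset.sum_congr rfl hL, Finset.sum_add_distrib, Finset.sum_congr rfl fun m _ => hR m,
      Finset.sum_range_succ' _ (N + 1)]
    simp only [pdoCoeff_pascal n, add_smul, Finset.sum_add_distrib, Nat.add_sub_add_right]
    rw [Finset.sum_range_succ' _ N, pdoCoeff_zero_right, pdoCoeff_zero_right]
    rw [Finset.sum_range_succ (fun m => pdoCoeff (n + 1) (m + 1) •
      (a n * d^[m + 1] (b' (N - m)))) N]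
    have z : d^[N + 1] (b' (N - N)) = 0 := by
      rw [Nat.sub_self, h0, iterate_map_zero]
    simp only [z, Nat.add_sub_add_right, mul_zero, smul_zero, add_zero]
    abel

/-- The realization of `∑ aₙ D⁻ⁿ` as the power series `∑ ι(aₙ) sⁿ (1 + sδ)⁻ⁿ` in a central
variable `s`, where `δ` is an element of a ring over `R` that plays the role of `D`. -/
noncomputable def pdoRealize (ι : R →+* E) (δ : E) : (ℕ → R) →+ PowerSeries E where
  toFun a := PowerSeries.mk fun k =>
    ∑ n ∈ Finset.range (k + 1), pdoCoeff n (k - n) • (ι (a n) * δ ^ (k - n))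
  map_zero' := by ext k; simp
  map_add' a b := by
    ext k
    simp [add_mul, Finset.sum_add_distrib]

theorem coeff_pdoRealize (ι : R →+* E) (δ : E) (a : ℕ → R) (k : ℕ) :
    PowerSeries.coeff k (pdoRealize ι δ a) =
      ∑ n ∈ Finset.range (k + 1), pdoCoeff n (k - n) • (ι (a n) * δ ^ (k - n)) := by
  simp [pdoRealize]

theorem coeff_pdoRealize_congr (ι : R →+* E) (δ : E) {a b : ℕ → R} {k : ℕ}
    (h : ∀ n ≤ k, a n = b n) :
    PowerSeries.coeff k (pdoRealize ι δ a) = PowerSeries.coeff k (pdoRealize ι δ b) := by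
  rw [coeff_pdoRealize, coeff_pdoRealize]
  refine Finset.sum_congr rfl fun n hn => ?_
  rw [h n (by rw [Finset.mem_range] at hn; omega)]

theorem coeff_pdoRealize_eq_zero (ι : R →+* E) (δ : E) {a : ℕ → R} {i : ℕ}
    (h : ∀ n < i, a n = 0) {k : ℕ} (hk : k < i) :
    PowerSeries.coeff k (pdoRealize ι δ a) = 0 := by
  rw [coeff_pdoRealize_congr ι δ (b := 0) fun n hn => h n (by omega), map_zero, map_zero]

theorem eq_zero_of_coeff_pdoRealize (ι : R →+* E) (hι : Function.Injective ι) (δ : E)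
    {a : ℕ → R} {i : ℕ} (h : ∀ k < i, PowerSeries.coeff k (pdoRealize ι δ a) = 0) :
    ∀ k < i, a k = 0 := by
  intro k
  induction k using Nat.strong_induction_on with
  | _ k ih =>
    intro hk
    have h1 := h k hk
    rw [coeff_pdoRealize, Finset.sum_range_succ, Finset.sum_eq_zero] at h1
    · rw [Nat.sub_self, pdoCoeff_zero_right, pow_zero, mul_one, one_smul, zero_add] at h1
      exact hι (h1.trans (map_zero ι).symm)
    · intro n hn
      rw [Finset.mem_range] at hn
      rw [ih n hn (by omega), map_zero, zero_mul, smul_zero]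

theorem pdoRealize_injective (ι : R →+* E) (hι : Function.Injective ι) (δ : E) :
    Function.Injective (pdoRealize ι δ) := by
  rw [injective_iff_map_eq_zero]
  intro a ha
  funext k
  exact eq_zero_of_coeff_pdoRealize ι hι δ (i := k + 1) (fun j _ => by rw [ha, map_zero]) k
    (by omega)

theorem pdoRealize_single_zero (ι : R →+* E) (δ : E) (r : R) :
    pdoRealize ι δ (Pi.single 0 r) = PowerSeries.C (ι r) := by
  ext k
  rw [coeff_pdoRealize, Finset.sum_eq_single 0]
  · cases k with
    | zero => simp [pdoCoeff_zero_right]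
    | succ k => simp [pdoCoeff_zero_succ]
  · intro n _ hn
    simp [hn]
  · simp

theorem pdoRealize_shift_mul (ι : R →+* E) (δ : E) (a : ℕ → R) :
    pdoRealize ι δ (pdoShift a) * (1 + PowerSeries.X * PowerSeries.C δ) =
      pdoRealize ι δ a * PowerSeries.X := by
  rw [mul_add, mul_one, ← mul_assoc]
  ext k
  cases k with
  | zero =>
    rw [map_add, PowerSeries.coeff_zero_mul_X, PowerSeries.coeff_mul_C,
      PowerSeries.coeff_zero_mul_X, coeff_pdoRealize]
    simp [pdoShift]
  | succ k =>
    rw [map_add, PowerSeries.coeff_succ_mul_X, PowerSeries.coeff_mul_C,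
      PowerSeries.coeff_succ_mul_X]
    simp only [coeff_pdoRealize]
    rw [Finset.sum_range_succ' _ (k + 1), Finset.sum_range_succ'
      (fun n => pdoCoeff n (k - n) • (ι (pdoShift a n) * δ ^ (k - n))) k]
    simp only [pdoShift, map_zero, zero_mul, smul_zero, add_zero, Nat.add_sub_add_right]
    rw [Finset.sum_range_succ, Finset.sum_range_succ _ k]
    simp only [Nat.sub_self, pdoCoeff_zero_right]
    rw [add_right_comm, Finset.sum_mul, ← Finset.sum_add_distrib]
    congr 1
    refine Finset.sum_congr rfl fun n hn => ?_
    obtain ⟨N, rfl⟩ : ∃ N, k = n + 1 + N := ⟨k - n - 1, by rw [Finset.mem_range] at hn; omega⟩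
    have i1 : n + 1 + N - n = N + 1 := by omega
    have i2 : n + 1 + N - (n + 1) = N := by omega
    rw [i1, i2, pdoCoeff_pascal n N, add_smul, smul_mul_assoc, mul_assoc, pow_succ]

theorem C_mul_pdoRealize (d : Derivation S R R) (ι : R →+* E) (δ : E)
    (hδ : ∀ r, δ * ι r = ι r * δ + ι (d r)) (a : ℕ → R) :
    PowerSeries.C δ * pdoRealize ι δ a =
      pdoRealize ι δ a * PowerSeries.C δ + pdoRealize ι δ (fun n => d (a n)) := by
  ext k
  rw [map_add, PowerSeries.coeff_C_mul, PowerSeries.coeff_mul_C]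
  simp only [coeff_pdoRealize]
  rw [Finset.mul_sum, Finset.sum_mul, ← Finset.sum_add_distrib]
  refine Finset.sum_congr rfl fun n _ => ?_
  rw [mul_smul_comm, smul_mul_assoc, ← smul_add, ← mul_assoc, hδ, add_mul, mul_assoc, mul_assoc,
    pow_mul_comm']

theorem mul_pdoRealize_eq (d : Derivation S R R) (ι : R →+* E) (δ : E)
    (hδ : ∀ r, δ * ι r = ι r * δ + ι (d r)) (b b' : ℕ → R) (h0 : b' 0 = 0)
    (h : ∀ k, b' (k + 1) + d (b' k) = b k) :
    (1 + PowerSeries.X * PowerSeries.C δ) * pdoRealize ι δ b' =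
      PowerSeries.X * pdoRealize ι δ b := by
  have hb : pdoShift b = b' + pdoShift (fun n => d (b' n)) := by
    funext k
    cases k with
    | zero => simp [pdoShift, h0]
    | succ k => simp [pdoShift, h]
  have h1 := pdoRealize_shift_mul ι δ b
  have h2 := pdoRealize_shift_mul ι δ (fun n => d (b' n))
  rw [hb, map_add, add_mul, h2, ← PowerSeries.X_mul, ← PowerSeries.X_mul] at h1
  rw [← h1, add_mul, one_mul, mul_assoc, C_mul_pdoRealize d ι δ hδ, mul_add, mul_add, mul_one,
    ← mul_assoc, ← mul_assoc, PowerSeries.X_mul, add_assoc]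

theorem exists_add_derivation_eq (d : R → R) (b : ℕ → R) :
    ∃ b' : ℕ → R, b' 0 = 0 ∧ ∀ k, b' (k + 1) + d (b' k) = b k := by
  refine ⟨fun k => Nat.rec 0 (fun k x => b k - d x) k, rfl, fun k => ?_⟩
  exact sub_add_cancel _ _

theorem powerSeries_X_mul_cancel {P Q : PowerSeries E}
    (h : PowerSeries.X * P = PowerSeries.X * Q) : P = Q := by
  ext k
  rw [← PowerSeries.coeff_succ_X_mul, h, PowerSeries.coeff_succ_X_mul]

theorem pdoRealize_pdoMul_single (d : Derivation S R R) (ι : R →+* E) (δ : E)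
    (hδ : ∀ r, δ * ι r = ι r * δ + ι (d r)) (n : ℕ) (r : R) (b : ℕ → R) :
    pdoRealize ι δ (pdoMul d (Pi.single n r) b) =
      pdoRealize ι δ (Pi.single n r) * pdoRealize ι δ b := by
  induction n generalizing b with
  | zero =>
    rw [pdoMul_single_zero_left, pdoRealize_single_zero]
    ext k
    rw [PowerSeries.coeff_C_mul]
    simp only [coeff_pdoRealize]
    rw [Finset.mul_sum]
    refine Finset.sum_congr rfl fun n _ => ?_
    rw [mul_smul_comm, map_mul, mul_assoc]
  | succ n ih =>
    obtain ⟨b', h0, h⟩ := exists_add_derivation_eq d b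
    rw [← pdoShift_single, pdoMul_shift_left d _ b b' h0 h, ih b']
    apply powerSeries_X_mul_cancel
    rw [← mul_assoc, PowerSeries.X_mul, ← pdoRealize_shift_mul, mul_assoc,
      mul_pdoRealize_eq d ι δ hδ b b' h0 h, ← mul_assoc, ← mul_assoc, PowerSeries.X_mul]

theorem pdoRealize_pdoMul (d : Derivation S R R) (ι : R →+* E) (δ : E)
    (hδ : ∀ r, δ * ι r = ι r * δ + ι (d r)) (a b : ℕ → R) :
    pdoRealize ι δ (pdoMul d a b) = pdoRealize ι δ a * pdoRealize ι δ b := by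
  ext k
  let f : (ℕ → R) →+ E :=
    { toFun := fun a => PowerSeries.coeff k (pdoRealize ι δ (pdoMul d a b))
      map_zero' := by
        have : pdoMul d 0 b = 0 := funext fun n =>
          pdoMul_eq_zero_of_lt d 0 b (k := n + 1) (fun _ _ => rfl) n (by omega)
        rw [this, map_zero, map_zero]
      map_add' := fun a a' => by rw [pdoMul_add_left, map_add, map_add] }
  let g : (ℕ → R) →+ E :=
    { toFun := fun a => PowerSeries.coeff k (pdoRealize ι δ a * pdoRealize ι δ b)
      map_zero' := by rw [map_zero, zero_mul, map_zero]
      map_add' := fun a a' => by rw [map_add, add_mul, map_add] }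
  refine DFunLike.congr_fun (addMonoidHom_eq_of_eq_single f g (k + 1) (fun a ha => ?_)
    (fun a ha => ?_) fun n r => ?_) a
  · exact coeff_pdoRealize_eq_zero ι δ (pdoMul_eq_zero_of_lt d a b ha) (by omega)
  · change PowerSeries.coeff k (pdoRealize ι δ a * pdoRealize ι δ b) = 0
    rw [PowerSeries.coeff_mul]
    refine Finset.sum_eq_zero fun p hp => ?_
    rw [Finset.HasAntidiagonal.mem_antidiagonal] at hp
    rw [coeff_pdoRealize_eq_zero ι δ ha (by omega), zero_mul]
  · exact congrArg (PowerSeries.coeff k) (pdoRealize_pdoMul_single d ι δ hδ n r b)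

theorem mem_range_pdoRealize_of_coeff_eq (ι : R →+* E) (hι : Function.Injective ι) (δ : E)
    (P : PowerSeries E)
    (h : ∀ k, ∃ b, ∀ j < k, PowerSeries.coeff j (pdoRealize ι δ b) = PowerSeries.coeff j P) :
    ∃ b, pdoRealize ι δ b = P := by
  choose b hb using h
  refine ⟨fun k => b (k + 1) k, ?_⟩
  ext k
  rw [← hb (k + 1) k (by omega)]
  refine coeff_pdoRealize_congr ι δ fun n hn => ?_
  rw [← sub_eq_zero, ← Pi.sub_apply]
  refine eq_zero_of_coeff_pdoRealize ι hι δ (i := n + 1) (fun j hj => ?_) n (by omega)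
  rw [map_sub, map_sub, hb (n + 1) j hj, hb (k + 1) j (by omega), sub_self]

theorem existsUnique_pdoResolvent (d : R → R) (u : R) :
    ∃! v : ℕ → R, v = pdoE1 + pdoMul d (pdoMul d pdoE1 (pdoScalar u)) v := by
  refine existsUnique_eq_of_strictly_causal
    (fun v => pdoE1 + pdoMul d (pdoMul d pdoE1 (pdoScalar u)) v) fun k a b h => ?_
  rw [Pi.add_apply, Pi.add_apply, pdoMul_congr_right d _ _ k a b h]
  exact pdoMul_eq_zero_of_lt d _ _ (k := 1) (by simp [pdoE1]) 0 one_pos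

theorem pdoResolvent_zero_one (d : R → R) (u : R) (v : ℕ → R)
    (hv : v = pdoE1 + pdoMul d (pdoMul d pdoE1 (pdoScalar u)) v) : v 0 = 0 ∧ v 1 = 1 := by
  have hX : ∀ n < 1, pdoMul d pdoE1 (pdoScalar u) n = 0 :=
    pdoMul_eq_zero_of_lt d _ _ (by simp [pdoE1])
  have h0 : v 0 = 0 := by
    rw [hv, Pi.add_apply, pdoMul_eq_zero_of_lt d _ _ hX 0 one_pos]
    simp [pdoE1]
  refine ⟨h0, ?_⟩
  rw [hv, Pi.add_apply]
  simp [pdoMul, Finset.sum_range_succ, h0, pdoE1]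

theorem pdoRealize_twist_single_succ (d : Derivation S R R) (ι : R →+* E) (δ : E)
    (hδ : ∀ r, δ * ι r = ι r * δ + ι (d r)) (u : R) (v : ℕ → R)
    (hv : v = pdoE1 + pdoMul d (pdoMul d pdoE1 (pdoScalar u)) v) (n : ℕ) (r : R) :
    pdoRealize ι (δ - ι u) (Pi.single (n + 1) r) =
      pdoRealize ι (δ - ι u) (Pi.single n r) * pdoRealize ι δ v := by
  have hE : (1 + PowerSeries.X * PowerSeries.C δ) * pdoRealize ι δ pdoE1 = PowerSeries.X := by
    rw [mul_pdoRealize_eq d ι δ hδ (Pi.single 0 1) pdoE1 (by simp [pdoE1]),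
      pdoRealize_single_zero, map_one, map_one, mul_one]
    intro k
    cases k <;> simp [pdoE1, apply_ite d]
  have hV : (1 + PowerSeries.X * PowerSeries.C (δ - ι u)) * pdoRealize ι δ v =
      PowerSeries.X := by
    have h1 := congrArg (fun x => (1 + PowerSeries.X * PowerSeries.C δ) * pdoRealize ι δ x) hv
    simp only [map_add, pdoRealize_pdoMul d ι δ hδ, pdoScalar_eq_single,
      pdoRealize_single_zero] at h1
    rw [mul_add, ← mul_assoc, ← mul_assoc, hE] at h1
    rw [map_sub, mul_sub, ← add_sub_assoc, sub_mul, h1, add_sub_cancel_right]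
  apply powerSeries_X_mul_cancel
  conv_lhs => rw [PowerSeries.X_mul, ← hV]
  rw [← mul_assoc, ← pdoShift_single, pdoRealize_shift_mul, ← mul_assoc, PowerSeries.X_mul]

theorem exists_pdoRealize_eq_twist (d : Derivation S R R) (ι : R →+* E)
    (hι : Function.Injective ι) (δ : E)
    (hδ : ∀ r, δ * ι r = ι r * δ + ι (d r)) (u : R) (a : ℕ → R) :
    ∃ b, pdoRealize ι δ b = pdoRealize ι (δ - ι u) a := by
  obtain ⟨v, hv, -⟩ := existsUnique_pdoResolvent d u
  have hs : ∀ n r, ∃ b, pdoRealize ι δ b = pdoRealize ι (δ - ι u) (Pi.single n r) := by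
    intro n r
    induction n with
    | zero => exact ⟨Pi.single 0 r, by rw [pdoRealize_single_zero, pdoRealize_single_zero]⟩
    | succ n ih =>
      obtain ⟨b, hb⟩ := ih
      exact ⟨pdoMul d b v, by
        rw [pdoRealize_pdoMul d ι δ hδ, hb, pdoRealize_twist_single_succ d ι δ hδ u v hv]⟩
  choose b hb using hs
  refine mem_range_pdoRealize_of_coeff_eq ι hι δ _ fun k => ⟨∑ i ∈ Finset.range k, b i (a i), ?_⟩
  intro j hj
  rw [map_sum, Finset.sum_congr rfl fun i _ => hb i (a i), ← map_sum]
  refine coeff_pdoRealize_congr ι _ fun n hn => ?_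
  rw [Finset.sum_apply, Finset.sum_pi_single]
  simp [hn.trans_lt hj]

theorem pdoMul_single_single_one (d : Derivation S R R) (n j : ℕ) (r : R) :
    pdoMul d (Pi.single n r) (Pi.single j 1) = Pi.single (n + j) r := by
  induction n generalizing j with
  | zero =>
    rw [pdoMul_single_zero_left]
    funext k
    simp [Pi.single_apply]
  | succ n ih =>
    rw [← pdoShift_single, pdoMul_shift_left d _ _ (Pi.single (j + 1) 1) (by simp), ih (j + 1)]
    · congr 1
      omega
    · intro k
      simp [Pi.single_apply, apply_ite d]

theorem existsUnique_pdoTwist (d : Derivation S R R) (u : R) (v : ℕ → R)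
    (hv : v = pdoE1 + pdoMul d (pdoMul d pdoE1 (pdoScalar u)) v) :
    ∃! T : (ℕ → R) → (ℕ → R),
      Function.Bijective T ∧
      (∀ a b : ℕ → R, T (a + b) = T a + T b) ∧
      (∀ a b : ℕ → R, T (pdoMul d a b) = pdoMul d (T a) (T b)) ∧
      (∀ i : ℕ, ∃ j : ℕ, ∀ a : ℕ → R, (∀ n < j, a n = 0) → ∀ n < i, T a n = 0) ∧
      (∀ g : R, T (pdoScalar g) = pdoScalar g) ∧
      T pdoE1 = v := by
  let ι : R →+* AddMonoid.End R := Module.toAddMonoidEnd R R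
  let δ : AddMonoid.End R := (d : R →+ R)
  have hι : Function.Injective ι := fun r s h => by
    have h1 : r * 1 = s * 1 := DFunLike.congr_fun h (1 : R)
    rwa [mul_one, mul_one] at h1
  have hδ : ∀ r, δ * ι r = ι r * δ + ι (d r) := by
    intro r
    ext x
    change d (r * x) = r * d x + d r * x
    rw [d.leibniz, smul_eq_mul, smul_eq_mul, mul_comm x]
  have hδ' : ∀ r, (δ - ι u) * ι r = ι r * (δ - ι u) + ι (d r) := by
    intro r
    rw [sub_mul, hδ, mul_sub, ← map_mul, ← map_mul, mul_comm u r]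
    abel
  have hinj := pdoRealize_injective ι hι δ
  choose T hT using exists_pdoRealize_eq_twist d ι hι δ hδ u
  refine ⟨T, ⟨⟨fun a b hab => ?_, fun b => ?_⟩, fun a b => ?_, fun a b => ?_, fun i => ⟨i, ?_⟩,
    fun g => ?_, ?_⟩, ?_⟩
  · exact pdoRealize_injective ι hι (δ - ι u) (by rw [← hT, ← hT, hab])
  · obtain ⟨a, ha⟩ := exists_pdoRealize_eq_twist d ι hι (δ - ι u) hδ' (-u) b
    rw [map_neg, sub_neg_eq_add, sub_add_cancel] at ha
    exact ⟨a, hinj (by rw [hT, ha])⟩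
  · exact hinj (by rw [hT, map_add, map_add, hT, hT])
  · exact hinj (by rw [hT, pdoRealize_pdoMul d ι _ hδ', pdoRealize_pdoMul d ι _ hδ, hT, hT])
  · intro a ha
    refine eq_zero_of_coeff_pdoRealize ι hι δ fun k hk => ?_
    rw [hT, coeff_pdoRealize_eq_zero ι _ ha hk]
  · apply hinj
    rw [hT, pdoScalar_eq_single, pdoRealize_single_zero, pdoRealize_single_zero]
  · apply hinj
    rw [hT, pdoE1_eq_single, ← zero_add 1, pdoRealize_twist_single_succ d ι δ hδ u v hv,
      pdoRealize_single_zero, map_one, map_one, one_mul]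
  · rintro T' ⟨-, hadd', hmul', hcont', hsc', he'⟩
    have hadd : ∀ a b, T (a + b) = T a + T b := fun a b =>
      hinj (by rw [hT, map_add, map_add, hT, hT])
    have hs : ∀ n r, T' (Pi.single n r) = T (Pi.single n r) := by
      intro n r
      induction n with
      | zero =>
        rw [← pdoScalar_eq_single, hsc']
        apply hinj
        rw [hT, pdoScalar_eq_single, pdoRealize_single_zero, pdoRealize_single_zero]
      | succ n ih =>
        apply hinj
        rw [hT, pdoRealize_twist_single_succ d ι δ hδ u v hv, ← hT, ← ih, ← he',
          ← pdoRealize_pdoMul d ι δ hδ, ← hmul', pdoE1_eq_single, pdoMul_single_single_one]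
    funext a i
    obtain ⟨j, hj⟩ := hcont' (i + 1)
    let f : (ℕ → R) →+ R := (Pi.evalAddMonoidHom _ i).comp (AddMonoidHom.mk' T' hadd')
    let g : (ℕ → R) →+ R := (Pi.evalAddMonoidHom _ i).comp (AddMonoidHom.mk' T hadd)
    refine DFunLike.congr_fun (addMonoidHom_eq_of_eq_single f g (max j (i + 1)) (fun a ha => ?_)
      (fun a ha => ?_) fun n r => congrFun (hs n r) i) a
    · exact hj a (fun n hn => ha n (lt_max_of_lt_left hn)) i (by omega)
    · refine eq_zero_of_coeff_pdoRealize ι hι δ (a := T a) (i := i + 1) (fun k hk => ?_) i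
        (by omega)
      rw [hT, coeff_pdoRealize_eq_zero ι _ (fun n hn => ha n (lt_max_of_lt_right hn)) hk]

theorem pdoMul_smul_left (d : R → R) (c : S) (a b : ℕ → R) :
    pdoMul d (c • a) b = c • pdoMul d a b := by
  funext k
  simp only [pdoMul, Pi.smul_apply, Finset.smul_sum, smul_mul_assoc]
  exact Finset.sum_congr rfl fun n _ => Finset.sum_congr rfl fun m _ => smul_comm _ _ _

theorem pdoMul_smul_right (d : Derivation S R R) (c : S) (a b : ℕ → R) :
    pdoMul d a (c • b) = c • pdoMul d a b := by
  have hit : ∀ (m : ℕ) (f : R), d^[m] (c • f) = c • d^[m] f := by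
    intro m f
    induction m with
    | zero => rfl
    | succ m ih =>
      rw [Function.iterate_succ_apply', ih, d.map_smul, Function.iterate_succ_apply']
  funext k
  simp only [pdoMul, Pi.smul_apply, hit, Finset.smul_sum, mul_smul_comm]
  exact Finset.sum_congr rfl fun n _ => Finset.sum_congr rfl fun m _ => smul_comm _ _ _

theorem smul_pdoMul_pdoMul_pdoScalar (d : Derivation S R R) (c : S) (a b : ℕ → R) (g : R) :
    c • pdoMul d (pdoMul d a (pdoScalar g)) b =
      pdoMul d (pdoMul d a (pdoScalar (c • g))) b := by
  have hsc : pdoScalar (c • g) = c • pdoScalar g := by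
    funext n
    simp [pdoScalar]
  rw [hsc, pdoMul_smul_right, pdoMul_smul_left]

theorem exists_derivation_coe_eq (D : R → R) (hadd : ∀ f g, D (f + g) = D f + D g)
    (hsmul : ∀ (c : S) f, D (c • f) = c • D f) (hmul : ∀ f g, D (f * g) = f * D g + g * D f) :
    ∃ d : Derivation S R R, D = ⇑d :=
  ⟨Derivation.mk' { toFun := D, map_add' := hadd, map_smul' := hsmul } hmul, rfl⟩

end Algebra

section Laurent

/-- The Euler operator `z · d/dz` satisfies the Leibniz rule. -/
theorem laurentSeries_euler_mul (E : LaurentSeries ℂ → LaurentSeries ℂ)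
    (hE : ∀ (f : LaurentSeries ℂ) (n : ℤ), (E f).coeff n = (n : ℂ) * f.coeff n)
    (f g : LaurentSeries ℂ) : E (f * g) = E f * g + f * E g := by
  have hsupp : ∀ h : LaurentSeries ℂ, (E h).support ⊆ h.support := by
    intro h n hn h0
    exact hn (by rw [hE, h0, mul_zero])
  ext n
  rw [hE, HahnSeries.coeff_add, HahnSeries.coeff_mul,
    HahnSeries.coeff_mul_left' f.isPWO_support (hsupp f),
    HahnSeries.coeff_mul_right' g.isPWO_support (hsupp g), Finset.mul_sum,
    ← Finset.sum_add_distrib]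
  refine Finset.sum_congr rfl fun p hp => ?_
  have hp' : p.1 + p.2 = n := (Finset.mem_antidiagonal.mp hp).2.2
  rw [hE, hE, ← hp']
  push_cast
  ring

theorem laurentSeries_leibniz (D : LaurentSeries ℂ → LaurentSeries ℂ)
    (hD : ∀ (f : LaurentSeries ℂ) (n : ℤ), (D f).coeff n = ((n + 1 : ℤ) : ℂ) * f.coeff (n + 1))
    (f g : LaurentSeries ℂ) : D (f * g) = f * D g + g * D f := by
  have hE := laurentSeries_euler_mul (fun f => HahnSeries.single 1 1 * D f)
    (fun f n => by rw [HahnSeries.coeff_single_mul, hD, sub_add_cancel, one_mul]) f g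
  have h1 : (HahnSeries.single (-1) 1 : LaurentSeries ℂ) * HahnSeries.single 1 1 = 1 := by
    rw [HahnSeries.single_mul_single]
    simp
  have h2 := congrArg (fun x => (HahnSeries.single (-1) 1 : LaurentSeries ℂ) * x) hE
  beta_reduce at h2
  linear_combination h2 + (D f * g + f * D g - D (f * g)) * h1

end Laurent

/-- for `K = ℂ((z))` with `∂ = d/dz` and `ℓ ∈ ℂ`:
(i) there is a unique `v ∈ ΨDO(K,∂)_{≤0}` with `v = e₁ + ℓ·(e₁ * (z⁻¹·e₀) * v)`
(representing `(D − ℓ·z⁻¹)⁻¹`), and it satisfies `v_0 = 0`, `v_1 = 1`;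
(ii) there is a unique ℂ-algebra automorphism `T` of `ΨDO(K,∂)_{≤0}`, continuous
for the filtration topology, fixing `g·e₀` for all `g ∈ ℂ((z))` and sending `e₁`
to `v` (the restriction of `A ↦ z^ℓ·A·z^{−ℓ}` to operators of degree ≤ 0). -/
theorem pdo_twist_exists_unique (ℓ : ℂ)
    (D : LaurentSeries ℂ → LaurentSeries ℂ)
    (hD : ∀ (f : LaurentSeries ℂ) (n : ℤ), (D f).coeff n = ((n + 1 : ℤ) : ℂ) * f.coeff (n + 1)) :
    (∃! v : ℕ → LaurentSeries ℂ,
      v = pdoE1 + ℓ • pdoMul D (pdoMul D pdoE1 (pdoScalar zLS⁻¹)) v) ∧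
    (∀ v : ℕ → LaurentSeries ℂ,
      v = pdoE1 + ℓ • pdoMul D (pdoMul D pdoE1 (pdoScalar zLS⁻¹)) v →
      v 0 = 0 ∧ v 1 = 1 ∧
      ∃! T : (ℕ → LaurentSeries ℂ) → (ℕ → LaurentSeries ℂ),
        Function.Bijective T ∧
        (∀ a b : ℕ → LaurentSeries ℂ, T (a + b) = T a + T b) ∧
        (∀ (c : ℂ) (a : ℕ → LaurentSeries ℂ), T (c • a) = c • T a) ∧
        (∀ a b : ℕ → LaurentSeries ℂ, T (pdoMul D a b) = pdoMul D (T a) (T b)) ∧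
        (∀ i : ℕ, ∃ j : ℕ, ∀ a : ℕ → LaurentSeries ℂ,
          (∀ n < j, a n = 0) → ∀ n < i, T a n = 0) ∧
        (∀ g : LaurentSeries ℂ, T (pdoScalar g) = pdoScalar g) ∧
        T pdoE1 = v) := by
  have hsmul : ∀ (c : ℂ) (f : LaurentSeries ℂ), D (c • f) = c • D f := by
    intro c f
    ext n
    simp only [hD, HahnSeries.coeff_smul, smul_eq_mul]
    ring
  have hadd : ∀ f g : LaurentSeries ℂ, D (f + g) = D f + D g := by
    intro f g
    ext n
    simp only [hD, HahnSeries.coeff_add, mul_add]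
  let _ : Algebra ℂ (LaurentSeries ℂ) := HahnSeries.instAlgebra
  obtain ⟨d, rfl⟩ :=
    exists_derivation_coe_eq (S := ℂ) D hadd hsmul (laurentSeries_leibniz D hD)
  simp only [smul_pdoMul_pdoMul_pdoScalar d]
  refine ⟨existsUnique_pdoResolvent d _, fun v hv => ?_⟩
  obtain ⟨h0, h1⟩ := pdoResolvent_zero_one d _ v hv
  refine ⟨h0, h1, ?_⟩
  obtain ⟨T, ⟨hb, ha, hm, hc, hs, he⟩, huniq⟩ := existsUnique_pdoTwist d _ v hv
  refine ⟨T, ⟨hb, ha, fun c a => ?_, hm, hc, hs, he⟩,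
    fun T' ⟨hb', ha', _, hm', hc', hs', he'⟩ => huniq T' ⟨hb', ha', hm', hc', hs', he'⟩⟩
  have key : ∀ b : ℕ → LaurentSeries ℂ, c • b = pdoMul d (pdoScalar (HahnSeries.C c)) b := by
    intro b
    rw [pdoScalar_eq_single, pdoMul_single_zero_left]
    funext k
    rw [Pi.smul_apply, HahnSeries.C_mul_eq_smul]
  rw [key, hm, hs, ← key]
end
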